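/- Let R → S be a ring homomorphism such that the multiplication map S ⊗_R S → S is bijective and such that Tor_i^R(S, S) = 0 for all 1 ≤ i ≤ n, for some fixed integer n ≥ 1. Then for every left S-module M: (1) the action map S ⊗_R M → M, s ⊗ m ↦ s·m, is bijective; and (2) Tor_i^R(S, M) = 0 for all 1 ≤ i ≤ n. -/

import Mathlib

open MulOpposite

universe u

section BTensorCore

variable (R : Type u) [Ring R]
variable (M : Type u) [AddCommGroup M] [Module Rᵐᵒᵖ M]
variable (N : Type u) [AddCommGroup N] [Module R N]

/-- The subgroup of relations defining the balanced tensor product `M ⊗_R N`. -/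
noncomputable def btRel : AddSubgroup (TensorProduct ℤ M N) :=
  AddSubgroup.closure
    { x | ∃ (m : M) (r : R) (n : N), x = (op r • m) ⊗ₜ[ℤ] n - m ⊗ₜ[ℤ] (r • n) }

/-- The balanced tensor product `M ⊗_R N` of a right `R`-module `M` and a left `R`-module `N`:
the quotient of `M ⊗_ℤ N` by the relations `(m · r) ⊗ n = m ⊗ (r · n)`. -/
abbrev BTensor : Type u := TensorProduct ℤ M N ⧸ btRel R M N

variable {R M N}

/-- The image of `m ⊗ n` in `M ⊗_R N`. -/
noncomputable def BTensor.tmul (m : M) (n : N) : BTensor R M N :=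
  QuotientAddGroup.mk (m ⊗ₜ[ℤ] n)

variable {A : Type u} [AddCommGroup A]

/-- Lift a balanced biadditive map `M → N → A` to `M ⊗_R N → A`. -/
noncomputable def BTensor.lift (b : M →+ N →+ A)
    (hb : ∀ (r : R) (m : M) (n : N), b (op r • m) n = b m (r • n)) :
    BTensor R M N →+ A :=
  QuotientAddGroup.lift (btRel R M N)
    (TensorProduct.liftAddHom b (fun z m n => by
      simp [map_zsmul]))
    ((AddSubgroup.closure_le _).mpr (by
      rintro y ⟨m, r, n, rfl⟩
      simp [AddMonoidHom.mem_ker, hb r m n]))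

/-- Lift a balanced biadditive map given as a bare function. -/
noncomputable def BTensor.lift' (b : M → N → A)
    (h1 : ∀ m m' n, b (m + m') n = b m n + b m' n)
    (h2 : ∀ m n n', b m (n + n') = b m n + b m n')
    (hb : ∀ (r : R) m n, b (op r • m) n = b m (r • n)) :
    BTensor R M N →+ A :=
  BTensor.lift (AddMonoidHom.mk' (fun m => AddMonoidHom.mk' (b m) (h2 m))
    (fun m m' => AddMonoidHom.ext fun n => h1 m m' n)) hb

section MapRight

variable {N' : Type u} [AddCommGroup N'] [Module R N']

/-- The map `1 ⊗ g : M ⊗_R N → M ⊗_R N'` induced by a map `g` of left `R`-modules. -/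
noncomputable def BTensor.mapRight (g : N →ₗ[R] N') : BTensor R M N →+ BTensor R M N' :=
  QuotientAddGroup.map _ _
    (TensorProduct.map (LinearMap.id (R := ℤ) (M := M)) g.toAddMonoidHom.toIntLinearMap).toAddMonoidHom
    ((AddSubgroup.closure_le _).mpr (by
      rintro y ⟨m, r, n, rfl⟩
      refine AddSubgroup.mem_comap.mpr (AddSubgroup.subset_closure ?_)
      exact ⟨m, r, g n, by simp⟩))

end MapRight

section MapLeft

variable {M' : Type u} [AddCommGroup M'] [Module Rᵐᵒᵖ M']

/-- The map `g ⊗ 1 : M ⊗_R N → M' ⊗_R N` induced by a map `g` of right `R`-modules. -/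
noncomputable def BTensor.mapLeft (g : M →ₗ[Rᵐᵒᵖ] M') : BTensor R M N →+ BTensor R M' N :=
  QuotientAddGroup.map _ _
    (TensorProduct.map g.toAddMonoidHom.toIntLinearMap (LinearMap.id (R := ℤ) (M := N))).toAddMonoidHom
    ((AddSubgroup.closure_le _).mpr (by
      rintro y ⟨m, r, n, rfl⟩
      refine AddSubgroup.mem_comap.mpr (AddSubgroup.subset_closure ?_)
      exact ⟨g m, r, n, by simp⟩))

end MapLeft

end BTensorCore

/-- `Tor_i^R(M, N) = 0` for all `1 ≤ i ≤ n`: for every exact sequence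
`F (n+1) → F n → ⋯ → F 1 → F 0 → M → 0` of right `R`-modules with each `F j` projective
(`j ≤ n+1`), the induced complex `F (n+1) ⊗_R N → ⋯ → F 0 ⊗_R N` is exact at positions `1`
through `n`. -/
def TorVanishesUpTo (R : Type u) [Ring R] (n : ℕ)
    (M : Type u) [AddCommGroup M] [Module Rᵐᵒᵖ M]
    (N : Type u) [AddCommGroup N] [Module R N] : Prop :=
  ∀ (F : ℕ → Type u) (_ : ∀ j, AddCommGroup (F j)) (_ : ∀ j, Module Rᵐᵒᵖ (F j))
    (d : ∀ j, F (j + 1) →ₗ[Rᵐᵒᵖ] F j) (e : F 0 →ₗ[Rᵐᵒᵖ] M),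
    (∀ j, j ≤ n + 1 → Module.Projective Rᵐᵒᵖ (F j)) →
    Function.Surjective e →
    (∀ x, e x = 0 ↔ x ∈ Set.range (d 0)) →
    (∀ j, j < n → ∀ x, d j x = 0 ↔ x ∈ Set.range (d (j + 1))) →
    ∀ j, j < n → ∀ x : BTensor R (F (j + 1)) N,
      BTensor.mapLeft (N := N) (d j) x = 0 ↔
        x ∈ Set.range (BTensor.mapLeft (N := N) (d (j + 1)))

namespace BTensor

section Basic

variable {R : Type u} [Ring R]
variable {M M' M'' : Type u} [AddCommGroup M] [Module Rᵐᵒᵖ M] [AddCommGroup M'] [Module Rᵐᵒᵖ M']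
  [AddCommGroup M''] [Module Rᵐᵒᵖ M'']
variable {N N' : Type u} [AddCommGroup N] [Module R N] [AddCommGroup N'] [Module R N']
variable {A : Type u} [AddCommGroup A]

theorem tmul_add (m : M) (n n' : N) :
    (tmul m (n + n') : BTensor R M N) = tmul m n + tmul m n' := by
  simp only [tmul, TensorProduct.tmul_add, QuotientAddGroup.mk_add]

theorem add_tmul (m m' : M) (n : N) :
    (tmul (m + m') n : BTensor R M N) = tmul m n + tmul m' n := by
  simp only [tmul, TensorProduct.add_tmul, QuotientAddGroup.mk_add]

theorem smul_tmul (r : R) (m : M) (n : N) :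
    (tmul (op r • m) n : BTensor R M N) = tmul m (r • n) := by
  rw [← sub_eq_zero]
  exact (QuotientAddGroup.eq_zero_iff _).mpr (AddSubgroup.subset_closure ⟨m, r, n, rfl⟩)

@[simp]
theorem lift'_tmul (b : M → N → A) (h1 : ∀ m m' n, b (m + m') n = b m n + b m' n)
    (h2 : ∀ m n n', b m (n + n') = b m n + b m n')
    (hb : ∀ (r : R) m n, b (op r • m) n = b m (r • n)) (m : M) (n : N) :
    lift' b h1 h2 hb (tmul m n) = b m n := rfl

@[simp]
theorem mapLeft_tmul (g : M →ₗ[Rᵐᵒᵖ] M') (m : M) (n : N) :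
    mapLeft g (tmul m n : BTensor R M N) = tmul (g m) n := rfl

@[simp]
theorem mapRight_tmul (g : N →ₗ[R] N') (m : M) (n : N) :
    mapRight g (tmul m n : BTensor R M N) = tmul m (g n) := rfl

theorem induction_on {p : BTensor R M N → Prop} (x : BTensor R M N)
    (tmul : ∀ m n, p (tmul m n)) (add : ∀ x y, p x → p y → p (x + y)) (zero : p 0) : p x := by
  obtain ⟨x, rfl⟩ := QuotientAddGroup.mk_surjective x
  induction x using TensorProduct.induction_on with
  | zero => exact zero
  | tmul m n => exact tmul m n
  | add x y hx hy => exact add _ _ hx hy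

theorem addHom_ext {g h : BTensor R M N →+ A} (H : ∀ m n, g (tmul m n) = h (tmul m n)) :
    g = h := by
  refine DFunLike.ext _ _ fun x => ?_
  induction x using induction_on with
  | tmul m n => exact H m n
  | add x y hx hy => rw [map_add, map_add, hx, hy]
  | zero => rw [map_zero, map_zero]

theorem mapLeft_mapRight (g : M →ₗ[Rᵐᵒᵖ] M') (h : N →ₗ[R] N') (x : BTensor R M N) :
    mapLeft g (mapRight h x) = mapRight h (mapLeft g x) :=
  DFunLike.congr_fun (addHom_ext (g := (mapLeft g).comp (mapRight h))
    (h := (mapRight h).comp (mapLeft g)) fun _ _ => rfl) x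

theorem mapLeft_mapLeft_eq_zero (g : M →ₗ[Rᵐᵒᵖ] M') (h : M' →ₗ[Rᵐᵒᵖ] M'')
    (hgh : ∀ x, h (g x) = 0) (x : BTensor R M N) : mapLeft h (mapLeft g x) = 0 := by
  induction x using induction_on with
  | tmul m n =>
    rw [mapLeft_tmul, mapLeft_tmul, hgh, ← zero_smul Rᵐᵒᵖ (0 : M''), ← op_zero, smul_tmul,
      zero_smul, ← add_eq_right (b := tmul (0 : M'') (0 : N)), ← tmul_add, add_zero]
  | add x y hx hy => rw [map_add, map_add, hx, hy, add_zero]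
  | zero => rw [map_zero, map_zero]

theorem mapLeft_surjective (g : M →ₗ[Rᵐᵒᵖ] M') (hg : Function.Surjective g) :
    Function.Surjective (mapLeft (N := N) g) := by
  intro y
  induction y using induction_on with
  | tmul m n =>
    obtain ⟨m, rfl⟩ := hg m
    exact ⟨tmul m n, rfl⟩
  | add x y hx hy =>
    obtain ⟨x, rfl⟩ := hx
    obtain ⟨y, rfl⟩ := hy
    exact ⟨x + y, map_add _ _ _⟩
  | zero => exact ⟨0, map_zero _⟩

theorem mem_range_mapLeft_of_mapLeft_eq_zero (d : M →ₗ[Rᵐᵒᵖ] M') (e : M' →ₗ[Rᵐᵒᵖ] M'')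
    (he : Function.Surjective e) (hde : ∀ x, e x = 0 → x ∈ Set.range d)
    (x : BTensor R M' N) (hx : mapLeft e x = 0) : x ∈ (mapLeft (N := N) d).range := by
  let π := QuotientAddGroup.mk' (mapLeft (N := N) d).range
  have key : ∀ (a b : M') (n : N), e a = e b → π (tmul a n) = π (tmul b n) := by
    intro a b n hab
    obtain ⟨y, hy⟩ := hde (a - b) (by rw [map_sub, hab, sub_self])
    have ha : a = d y + b := by rw [hy, sub_add_cancel]
    have h0 : π (tmul (d y) n) = 0 :=
      (QuotientAddGroup.eq_zero_iff _).mpr ⟨tmul y n, rfl⟩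
    rw [ha, add_tmul, map_add, h0, zero_add]
  let s := Function.surjInv he
  have hs : ∀ m, e (s m) = m := Function.surjInv_eq he
  let q : BTensor R M'' N →+ (BTensor R M' N ⧸ (mapLeft (N := N) d).range) :=
    lift' (fun m n => π (tmul (s m) n))
      (fun m m' n => by
        rw [← map_add, ← add_tmul]
        exact key _ _ _ (by rw [map_add, hs, hs, hs]))
      (fun m n n' => by rw [tmul_add, map_add])
      (fun r m n => by
        rw [← smul_tmul]
        exact key _ _ _ (by rw [map_smul, hs, hs]))
  have hq : q.comp (mapLeft e) = π := addHom_ext fun m n => key _ _ _ (hs _)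
  have hπ : π x = 0 := by rw [← hq, AddMonoidHom.comp_apply, hx, map_zero]
  exact (QuotientAddGroup.eq_zero_iff _).mp hπ

end Basic

section Act

variable {R S : Type u} [Ring R] [Ring S] {f : R →+* S} [Module R S]
variable {M : Type u} [AddCommGroup M] [Module S M] [Module R M]

/-- The left `R`-linear map `S → M`, `s ↦ s • m`, for an `S`-module `M` viewed as an `R`-module. -/
def orbitMap (hleft : ∀ (r : R) (x : S), r • x = f r * x)
    (hc : ∀ (r : R) (m : M), r • m = f r • m) (m : M) : S →ₗ[R] M where
  toFun s := s • m
  map_add' s t := add_smul s t m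
  map_smul' r s := by rw [hleft, hc, mul_smul, RingHom.id_apply]

variable {F G H : Type u} [AddCommGroup F] [Module Rᵐᵒᵖ F] [AddCommGroup G] [Module Rᵐᵒᵖ G]
  [AddCommGroup H] [Module Rᵐᵒᵖ H]

/-- The map `F ⊗_R S → F ⊗_R M`, `x ⊗ s ↦ x ⊗ s • m`, attached to `m : M`. -/
noncomputable def act (hleft : ∀ (r : R) (x : S), r • x = f r * x)
    (hc : ∀ (r : R) (m : M), r • m = f r • m) (m : M) : BTensor R F S →+ BTensor R F M :=
  mapRight (orbitMap hleft hc m)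

variable (hleft : ∀ (r : R) (x : S), r • x = f r * x) (hc : ∀ (r : R) (m : M), r • m = f r • m)

@[simp]
theorem act_tmul (m : M) (x : F) (s : S) : act hleft hc m (tmul x s) = tmul x (s • m) := rfl

theorem act_add (m m' : M) (x : BTensor R F S) :
    act hleft hc (m + m') x = act hleft hc m x + act hleft hc m' x :=
  DFunLike.congr_fun (addHom_ext (g := act hleft hc (m + m'))
    (h := act hleft hc m + act hleft hc m') fun x s => by simp [smul_add, tmul_add]) x

theorem act_act (s : S) (m : M) (x : BTensor R F S) :
    act hleft hc m (act hleft hleft s x) = act hleft hc (s • m) x :=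
  DFunLike.congr_fun (addHom_ext (g := (act hleft hc m).comp (act hleft hleft s))
    (h := act hleft hc (s • m)) fun x t => by simp [mul_smul]) x

theorem act_one (x : BTensor R F S) : act hleft hleft (1 : S) x = x :=
  DFunLike.congr_fun (addHom_ext (g := act hleft hleft (1 : S))
    (h := AddMonoidHom.id _) fun x t => by simp) x

theorem act_zero (x : BTensor R F S) : act hleft hc (0 : M) x = 0 := by
  simpa using act_add hleft hc 0 0 x

theorem mapLeft_act (g : F →ₗ[Rᵐᵒᵖ] G) (m : M) (x : BTensor R F S) :
    mapLeft g (act hleft hc m x) = act hleft hc m (mapLeft g x) :=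
  mapLeft_mapRight _ _ _

/-- The right `R`-module structure on `F ⊗_R S` coming from right multiplication on `S`. -/
@[reducible]
noncomputable def rightModule (F : Type u) [AddCommGroup F] [Module Rᵐᵒᵖ F] :
    Module Rᵐᵒᵖ (BTensor R F S) where
  smul r x := act hleft hleft (f r.unop) x
  one_smul x := by
    change act hleft hleft (f (unop 1)) x = x
    rw [unop_one, map_one, act_one]
  mul_smul r s x := by
    change act hleft hleft (f (unop (r * s))) x =
      act hleft hleft (f r.unop) (act hleft hleft (f s.unop) x)
    rw [act_act, unop_mul, map_mul, smul_eq_mul]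
  smul_zero r := map_zero (act hleft hleft (f r.unop))
  smul_add r x y := map_add (act hleft hleft (f r.unop)) x y
  add_smul r s x := by
    change act hleft hleft (f (unop (r + s))) x =
      act hleft hleft (f r.unop) x + act hleft hleft (f s.unop) x
    rw [unop_add, map_add, act_add]
  zero_smul x := by
    change act hleft hleft (f (unop 0)) x = 0
    rw [unop_zero, map_zero, act_zero]

/-- Lifting property of a projective module `F` with respect to `d ⊗ S`. -/
theorem exists_lift_mapLeft [Module.Projective Rᵐᵒᵖ F] (d : G →ₗ[Rᵐᵒᵖ] H)
    (g : F →+ BTensor R H S)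
    (hg : ∀ (r : R) (x : F), g (op r • x) = act hleft hleft (f r) (g x))
    (hd : ∀ x, g x ∈ (mapLeft (N := S) d).range) :
    ∃ σ : F →+ BTensor R G S,
      (∀ (r : R) (x : F), σ (op r • x) = act hleft hleft (f r) (σ x)) ∧
      ∀ x, mapLeft d (σ x) = g x := by
  let _ := rightModule hleft G
  let _ := rightModule hleft H
  let D : BTensor R G S →ₗ[Rᵐᵒᵖ] BTensor R H S :=
    { mapLeft (N := S) d with map_smul' := fun r x => mapLeft_act hleft hleft d (f r.unop) x }
  let g' : F →ₗ[Rᵐᵒᵖ] D.range :=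
    LinearMap.codRestrict D.range { g with map_smul' := fun r x => hg r.unop x } hd
  obtain ⟨σ, hσ⟩ := Module.projective_lifting_property D.rangeRestrict g'
    D.surjective_rangeRestrict
  exact ⟨σ.toAddMonoidHom, fun r x => σ.map_smul (op r) x,
    fun x => congrArg Subtype.val (LinearMap.congr_fun hσ x)⟩

/-- The map `F ⊗_R M → G ⊗_R M` induced by a right `R`-linear map `F → G ⊗_R S`. -/
noncomputable def extend (σ : F →+ BTensor R G S)
    (hσ : ∀ (r : R) (x : F), σ (op r • x) = act hleft hleft (f r) (σ x)) :
    BTensor R F M →+ BTensor R G M :=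
  lift' (fun x m => act hleft hc m (σ x))
    (fun x y m => by rw [map_add, map_add])
    (fun x m m' => act_add hleft hc m m' _)
    (fun r x m => by rw [hσ, act_act, hc])

@[simp]
theorem extend_tmul (σ : F →+ BTensor R G S)
    (hσ : ∀ (r : R) (x : F), σ (op r • x) = act hleft hleft (f r) (σ x)) (x : F) (m : M) :
    extend hleft hc σ hσ (tmul x m) = act hleft hc m (σ x) := rfl

/-- The map `F → F ⊗_R S`, `x ↦ x ⊗ 1`. -/
noncomputable def unit (R S : Type u) [Ring R] [Ring S] [Module R S] (F : Type u)
    [AddCommGroup F] [Module Rᵐᵒᵖ F] : F →+ BTensor R F S :=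
  AddMonoidHom.mk' (fun x => tmul x 1) fun x y => add_tmul x y 1

@[simp]
theorem unit_apply (x : F) : unit R S F x = tmul x 1 := rfl

theorem unit_smul (r : R) (x : F) :
    unit R S F (op r • x) = act hleft hleft (f r) (unit R S F x) := by
  rw [unit_apply, unit_apply, smul_tmul, act_tmul, hleft, mul_one, smul_eq_mul, one_mul]

/-- A contracting homotopy of `F ⊗_R S` in one degree gives exactness of `F ⊗_R M` there. -/
theorem mem_range_mapLeft_of_homotopy (d₀ : G →ₗ[Rᵐᵒᵖ] H) (d₁ : F →ₗ[Rᵐᵒᵖ] G)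
    (σ₀ : H →+ BTensor R G S)
    (hσ₀ : ∀ (r : R) (x : H), σ₀ (op r • x) = act hleft hleft (f r) (σ₀ x))
    (σ₁ : G →+ BTensor R F S)
    (hσ₁ : ∀ (r : R) (x : G), σ₁ (op r • x) = act hleft hleft (f r) (σ₁ x))
    (h : ∀ y, mapLeft d₁ (σ₁ y) = unit R S G y - σ₀ (d₀ y))
    (hc : ∀ (r : R) (m : M), r • m = f r • m)
    (x : BTensor R G M) (hx : mapLeft d₀ x = 0) : x ∈ (mapLeft (N := M) d₁).range := by
  have key : (mapLeft d₁).comp (extend hleft hc σ₁ hσ₁) +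
      (extend hleft hc σ₀ hσ₀).comp (mapLeft d₀) = AddMonoidHom.id (BTensor R G M) :=
    addHom_ext fun y m => by simp [mapLeft_act, h]
  refine ⟨extend hleft hc σ₁ hσ₁ x, ?_⟩
  simpa [hx] using DFunLike.congr_fun key x

end Act

end BTensor

open BTensor

/-- If `R → S` is a ring homomorphism such that the multiplication map `S ⊗_R S → S` is
bijective and `Tor_i^R(S, S) = 0` for `1 ≤ i ≤ n` (with `n ≥ 1`), then for every left
`S`-module `M` the action map `S ⊗_R M → M` is bijective and `Tor_i^R(S, M) = 0` for
`1 ≤ i ≤ n`. -/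
theorem bijective_actionMap_and_torVanishes_of_torVanishes_self
    {R S : Type u} [Ring R] [Ring S] (f : R →+* S) (n : ℕ) (hn : 1 ≤ n)
    [Module Rᵐᵒᵖ S] [Module R S]
    (hright : ∀ (r : R) (x : S), op r • x = x * f r)
    (hleft : ∀ (r : R) (x : S), r • x = f r * x)
    (hmul : Function.Bijective (BTensor.lift' (R := R) (M := S) (N := S) (fun x y => x * y)
      (fun x x' y => add_mul x x' y) (fun x y y' => mul_add x y y')
      (fun r x y => by simp only [hright, hleft, mul_assoc])))
    (htor : TorVanishesUpTo R n S S) :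
    ∀ (M : Type u) (_ : AddCommGroup M) (_ : Module S M) (_ : Module R M)
      (hc : ∀ (r : R) (m : M), r • m = f r • m),
      Function.Bijective (BTensor.lift' (R := R) (M := S) (N := M) (fun x m => x • m)
        (fun x x' m => add_smul x x' m) (fun x m m' => smul_add x m m')
        (fun r x m => by simp only [hright, hc, mul_smul])) ∧
      TorVanishesUpTo R n S M := by
  have hswap : ∀ s : S, (tmul s 1 : BTensor R S S) = tmul 1 s := fun s =>
    hmul.1 (by simp)
  intro M _ _ _ hc
  refine ⟨⟨?_, fun m => ⟨tmul 1 m, by simp⟩⟩, ?_⟩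
  · refine Function.LeftInverse.injective (g := fun m => tmul 1 m) fun x => ?_
    induction x using BTensor.induction_on with
    | tmul s m => simpa using (congrArg (act hleft hc m) (hswap s)).symm
    | add x y hx hy => simpa only [map_add, tmul_add] using congrArg₂ (· + ·) hx hy
    | zero => simpa using (congrArg (act hleft hc (0 : M)) (hswap 0)).symm.trans (act_zero ..)
  intro F _ _ d e hproj he hde hd
  have hexact := htor F _ _ d e hproj he hde hd
  have hdd : ∀ j, j < n → ∀ y, d j (d (j + 1) y) = 0 := fun j hj y =>
    (hd j hj _).mpr ⟨y, rfl⟩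
  have step : ∀ j, j < n → ∀ σ : F j →+ BTensor R (F (j + 1)) S,
      (∀ (r : R) x, σ (op r • x) = act hleft hleft (f r) (σ x)) →
      (∀ y, mapLeft (d j) (σ (d j y)) = tmul (d j y) 1) →
      ∃ τ : F (j + 1) →+ BTensor R (F (j + 2)) S,
        (∀ (r : R) x, τ (op r • x) = act hleft hleft (f r) (τ x)) ∧
        ∀ y, mapLeft (d (j + 1)) (τ y) = unit R S _ y - σ (d j y) := by
    intro j hj σ hσ hσd
    have := hproj (j + 1) (by lia)
    refine exists_lift_mapLeft hleft (d (j + 1)) (unit R S _ - σ.comp (d j).toAddMonoidHom)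
      (fun r x => ?_) (fun x => ?_)
    · simp [-unit_apply, unit_smul hleft, hσ]
    · exact (hexact j hj _).mp (by simp [hσd])
  have homotopy : ∀ j, j ≤ n → ∃ σ : F j →+ BTensor R (F (j + 1)) S,
      (∀ (r : R) x, σ (op r • x) = act hleft hleft (f r) (σ x)) ∧
      ∀ y, mapLeft (d j) (σ (d j y)) = tmul (d j y) 1 := by
    intro j
    induction j with
    | zero =>
      intro _
      have := hproj 0 (by lia)
      obtain ⟨t, ht⟩ := mapLeft_surjective (N := S) e he (tmul 1 1)
      let g : F 0 →+ BTensor R (F 0) S := unit R S _ -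
        AddMonoidHom.mk' (fun x => act hleft hleft (e x) t)
          (fun x y => by rw [map_add, act_add])
      obtain ⟨σ, hσ, hσd⟩ := exists_lift_mapLeft hleft (d 0) g
        (fun r x => by
          simp [g, -unit_apply, unit_smul hleft, act_act, hright])
        (fun x => mem_range_mapLeft_of_mapLeft_eq_zero (d 0) e he (fun y => (hde y).mp) _
          (by simp [g, mapLeft_act, ht, hswap]))
      refine ⟨σ, hσ, fun y => ?_⟩
      have h0 : e (d 0 y) = 0 := (hde _).mpr ⟨y, rfl⟩
      simp [hσd, g, h0, act_zero]
    | succ j ih =>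
      intro hj
      obtain ⟨σ, hσ, hσd⟩ := ih (by lia)
      obtain ⟨τ, hτ, hτd⟩ := step j hj σ hσ hσd
      exact ⟨τ, hτ, fun y => by simp [hτd, hdd j hj]⟩
  intro j hj x
  constructor
  · obtain ⟨σ, hσ, hσd⟩ := homotopy j hj.le
    obtain ⟨τ, hτ, hτd⟩ := step j hj σ hσ hσd
    exact mem_range_mapLeft_of_homotopy hleft (d j) (d (j + 1)) σ hσ τ hτ hτd hc x
  · rintro ⟨y, rfl⟩
    exact mapLeft_mapLeft_eq_zero _ _ (hdd j hj) y
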